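/- arXiv:2010.10494 — 2 statements merged into one kernel-verified Lean document; each statement's English description precedes it below -/
import Mathlib

section
/- For all integers m, s with s ≥ 5, m > 2s and m ≡ 2s − 1 (mod 2s), there exists a decentralized linear code of length ℓ = 3·(m + 1)/(2·s) + 1 for parameters (m, s) that is both correct and secure. -/
namespace SDPicod

/-- Side information set of user `i`: the `s` cyclically consecutive message
indices ending at `i`, i.e. `{i - k : k ∈ Finset.range s}`. -/
def sideInfo (m s : ℕ) (i : ZMod m) : Set (ZMod m) :=
  {j | ∃ k ∈ Finset.range s, j = i - (k : ZMod m)}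

/-- A decentralized linear code: every row is encodable by some user, i.e.
its support is contained in that user's side information set. -/
def IsDecentralizedCode (m s : ℕ) {ℓ : ℕ} (G : Fin ℓ → ZMod m → ZMod 2) : Prop :=
  ∀ t : Fin ℓ, ∃ i : ZMod m, Function.support (G t) ⊆ sideInfo m s i

/-- The set of message indices user `i` can decode: indices `j` outside the
side information set such that the standard basis vector `e j` lies in the
`GF(2)`-span of the rows of `G` together with the basis vectors of the
side information set. -/
def decSet (m s : ℕ) {ℓ : ℕ} (G : Fin ℓ → ZMod m → ZMod 2) (i : ZMod m) :
    Set (ZMod m) :=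
  {j | j ∉ sideInfo m s i ∧
    Pi.single j (1 : ZMod 2) ∈ Submodule.span (ZMod 2)
      (Set.range G ∪ {v | ∃ k ∈ sideInfo m s i, v = Pi.single k (1 : ZMod 2)})}

/-- Correctness: every user can decode at least one new message. -/
def Correct (m s : ℕ) {ℓ : ℕ} (G : Fin ℓ → ZMod m → ZMod 2) : Prop :=
  ∀ i : ZMod m, (decSet m s G i).Nonempty

/-- Security: no user can decode more than one new message. -/
def Secure (m s : ℕ) {ℓ : ℕ} (G : Fin ℓ → ZMod m → ZMod 2) : Prop :=
  ∀ i : ZMod m, (decSet m s G i).Subsingleton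

end SDPicod

open SDPicod

namespace SDPicod

/-- The window of user `u`, in terms of representatives `u, n < m`. -/
def Knows (m s u n : ℕ) : Prop := (n ≤ u ∧ u < n + s) ∨ (u < n ∧ u + m < n + s)

theorem mem_sideInfo_iff {m s : ℕ} [NeZero m] (hsm : s ≤ m) (i j : ZMod m) :
    j ∈ sideInfo m s i ↔ Knows m s i.val j.val := by
  have hi := ZMod.val_lt i
  have hj := ZMod.val_lt j
  simp only [sideInfo, Set.mem_ofPred_eq, Finset.mem_range, Knows]
  constructor
  · rintro ⟨k, hk, h⟩
    have h' : i = ((j.val + k : ℕ) : ZMod m) := by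
      rw [Nat.cast_add, ZMod.natCast_zmod_val, h, sub_add_cancel]
    have h2 := congrArg ZMod.val h'
    rw [ZMod.val_natCast] at h2
    rcases lt_or_ge (j.val + k) m with h3 | h3
    · rw [Nat.mod_eq_of_lt h3] at h2
      omega
    · rw [Nat.mod_eq_sub_mod h3, Nat.mod_eq_of_lt (by omega)] at h2
      omega
  · rintro (⟨h1, h2⟩ | ⟨h1, h2⟩)
    · refine ⟨i.val - j.val, by omega, ?_⟩
      rw [Nat.cast_sub h1, ZMod.natCast_zmod_val, ZMod.natCast_zmod_val, sub_sub_cancel]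
    · refine ⟨i.val + m - j.val, by omega, ?_⟩
      rw [Nat.cast_sub (by omega), Nat.cast_add, ZMod.natCast_self, ZMod.natCast_zmod_val,
        ZMod.natCast_zmod_val, add_zero, sub_sub_cancel]

theorem notMem_span_of_functional {m s ℓ : ℕ} {G : Fin ℓ → ZMod m → ZMod 2} {i j : ZMod m}
    (h : (ZMod m → ZMod 2) →ₗ[ZMod 2] ZMod 2) (hG : ∀ t, h (G t) = 0)
    (hA : ∀ k ∈ sideInfo m s i, h (Pi.single k 1) = 0) (hj : h (Pi.single j 1) ≠ 0) :
    j ∉ decSet m s G i := by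
  rintro ⟨-, hmem⟩
  have hle : Submodule.span (ZMod 2)
      (Set.range G ∪ {v | ∃ k ∈ sideInfo m s i, v = Pi.single k (1 : ZMod 2)}) ≤
      LinearMap.ker h := by
    rw [Submodule.span_le]
    rintro v (⟨t, rfl⟩ | ⟨k, hk, rfl⟩)
    · exact hG t
    · exact hA k hk
  exact hj (hle hmem)

theorem mem_decSet_of_row {m s ℓ : ℕ} [NeZero m] {G : Fin ℓ → ZMod m → ZMod 2} {i d : ZMod m}
    (hd : d ∉ sideInfo m s i) (t : Fin ℓ) (h1 : G t d = 1)
    (h0 : ∀ k, k ∉ sideInfo m s i → k ≠ d → G t k = 0) : d ∈ decSet m s G i := by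
  refine ⟨hd, ?_⟩
  set S := Submodule.span (ZMod 2)
    (Set.range G ∪ {v | ∃ k ∈ sideInfo m s i, v = Pi.single k (1 : ZMod 2)})
  have hsum : Pi.single d 1 + ∑ k ∈ Finset.univ.erase d, G t k • Pi.single k (1 : ZMod 2) =
      G t := by
    have hd1 : (Pi.single d 1 : ZMod m → ZMod 2) = G t d • Pi.single d 1 := by rw [h1, one_smul]
    rw [hd1, Finset.add_sum_erase Finset.univ (fun k => G t k • Pi.single k (1 : ZMod 2))
      (Finset.mem_univ d)]
    ext x
    simp [Finset.sum_apply, Pi.single_apply]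
  have hrest : ∑ k ∈ Finset.univ.erase d, G t k • Pi.single k (1 : ZMod 2) ∈ S := by
    refine Submodule.sum_mem _ fun k hk => ?_
    by_cases hkA : k ∈ sideInfo m s i
    · exact Submodule.smul_mem _ _ (Submodule.subset_span (Or.inr ⟨k, hkA, rfl⟩))
    · rw [h0 k hkA (Finset.ne_of_mem_erase hk), zero_smul]
      exact S.zero_mem
  have hG : G t ∈ S := Submodule.subset_span (Or.inl ⟨t, rfl⟩)
  rw [← hsum] at hG
  exact (Submodule.add_mem_iff_left _ hrest).1 hG

/-- `n` lies in the support of row `t`. Rows `0, 1, 2, 3` overlap; the rows `3 k + 1`, `3 k + 2`,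
`3 k + 3` with `1 ≤ k` are disjoint pairs inside the block `[2 s k, 2 s (k + 1))`. -/
def InRow (s t n : ℕ) : Prop :=
  (t = 0 ∧ (n = 0 ∨ n = 1 ∨ n = 2)) ∨ (t = 1 ∧ (n = 2 ∨ n = 3 ∨ n = s)) ∨
  (t = 2 ∧ (n + 1 = s ∨ n = s ∨ n = s + 1 ∨ n = s + 2)) ∨
  (t = 3 ∧ (n = s + 1 ∨ n = s + 2 ∨ n = s + 3 ∨ n + 1 = 2 * s)) ∨
  ∃ k, 1 ≤ k ∧ ((t = 3 * k + 1 ∧ (n = 2 * s * k ∨ n = 2 * s * k + 1)) ∨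
    (t = 3 * k + 2 ∧ (n = 2 * s * k + 2 ∨ n = 2 * s * k + s)) ∨
    (t = 3 * k + 3 ∧ (n = 2 * s * k + s + 1 ∨ n = 2 * s * k + s + 2)))

open Classical in
/-- The code with row supports `InRow`. -/
noncomputable def blockCode (m s ℓ : ℕ) (t : Fin ℓ) (j : ZMod m) : ZMod 2 :=
  if InRow s t j.val then 1 else 0

/-- Row `t` has `d` as its only element outside the window of user `u`. -/
def Misses (m s u t d : ℕ) : Prop :=
  InRow s t d ∧ ¬ Knows m s u d ∧ ∀ n, InRow s t n → n ≠ d → Knows m s u n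

open Classical in
/-- The vector with support `n :: L` is orthogonal to all rows and vanishes on the window of
user `u`. -/
def IsCheck (m s u n : ℕ) (L : List ℕ) : Prop :=
  (∀ x ∈ L, x < m ∧ x ≠ n ∧ ¬ Knows m s u x) ∧
    ∀ t, ((n :: L).map fun x => if InRow s t x then (1 : ZMod 2) else 0).sum = 0

theorem two_mul_le_block {s k : ℕ} (hk : 1 ≤ k) : 2 * s ≤ 2 * s * k :=
  Nat.le_mul_of_pos_right _ hk

theorem block_add_le {s k l : ℕ} (h : k < l) : 2 * s * k + 2 * s ≤ 2 * s * l := by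
  rw [← Nat.mul_succ]
  exact Nat.mul_le_mul_left _ h

theorem block_lt_cases {s k l : ℕ} (h : k < l) :
    2 * s * k + 2 * s = 2 * s * l ∨ 2 * s * k + 2 * s + 2 * s ≤ 2 * s * l := by
  obtain rfl | h' := Nat.succ_le_iff.2 h |>.eq_or_lt
  · exact Or.inl (Nat.mul_succ _ _).symm
  · refine Or.inr ?_
    rw [← Nat.mul_succ, ← Nat.mul_succ]
    exact Nat.mul_le_mul_left _ h'

theorem block_trichotomy (s k l : ℕ) :
    k = l ∨ 2 * s * k + 2 * s ≤ 2 * s * l ∨ 2 * s * l + 2 * s ≤ 2 * s * k := by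
  rcases lt_trichotomy k l with h | h | h
  · exact Or.inr (Or.inl (block_add_le h))
  · exact Or.inl h
  · exact Or.inr (Or.inr (block_add_le h))

theorem InRow.lt_of_le {m s q t n : ℕ} (hs : 5 ≤ s) (hq : 2 ≤ q) (hm : m + 1 = 2 * s * q)
    (ht : t ≤ 3 * q) (h : InRow s t n) : n < m := by
  have h2 := block_add_le (s := s) (show 1 < q by omega)
  rcases h with h | h | h | h | ⟨k, hk, h⟩
  iterate 4 omega
  have := block_add_le (s := s) (show k < q by omega)
  omega

/-- User `u` decodes message `d`. -/
def Target (m s q u d : ℕ) : Prop :=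
  (u = 1 ∧ d = 2) ∨ (3 ≤ u ∧ u < s ∧ d = s) ∨ (u = s ∧ d = 0) ∨ (u = s + 1 ∧ d = s + 2) ∨
  (u = s + 2 ∧ d = 2) ∨ (s + 3 ≤ u ∧ u + 1 < 2 * s ∧ d + 1 = 2 * s) ∨
  (u + 1 = 2 * s ∧ d + 1 = s) ∨ (u = 2 * s + 1 ∧ d = s + 1) ∨
  ∃ k, 1 ≤ k ∧ k < q ∧ ((u = 2 * s * k ∧ d = 2 * s * k + 1) ∨
    (2 * s * k + 2 ≤ u ∧ u < 2 * s * k + s ∧ d = 2 * s * k + s) ∨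
    (u = 2 * s * k + s ∧ d = 2 * s * k) ∨
    (u = 2 * s * k + s + 1 ∧ d = 2 * s * k + s + 2) ∨
    (2 * s * k + s + 2 ≤ u ∧ u < 2 * s * k + 2 * s ∧ d = 2 * s * k + 2) ∨
    (u = 0 ∧ 2 * s * k + 2 * s = m + 1 ∧ d = 2 * s * k + 2) ∨
    (u = 2 * s * k + 2 * s + 1 ∧ d = 2 * s * k + s + 1) ∨
    (u = 2 ∧ 2 * s * k + 2 * s = m + 1 ∧ d = 2 * s * k + s + 1))

theorem exists_target {m s q u : ℕ} (hs : 5 ≤ s) (hq : 2 ≤ q) (hm : m + 1 = 2 * s * q)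
    (hu : u < m) : ∃ d, Target m s q u d := by
  by_cases h02 : u = 0 ∨ u = 2
  · have hlast : 2 * s * (q - 1) + 2 * s = m + 1 := by
      rw [hm, ← Nat.mul_succ]
      congr 1
      omega
    rcases h02 with rfl | rfl
    · exact ⟨2 * s * (q - 1) + 2, by unfold Target; iterate 8 right
                                     exact ⟨q - 1, by omega, by omega, by omega⟩⟩
    · exact ⟨2 * s * (q - 1) + s + 1, by unfold Target; iterate 8 right
                                         exact ⟨q - 1, by omega, by omega, by omega⟩⟩
  by_cases hspec : u < 2 * s ∨ u = 2 * s + 1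
  · have hcases : u = 1 ∨ (3 ≤ u ∧ u < s) ∨ u = s ∨ u = s + 1 ∨ u = s + 2 ∨
        (s + 3 ≤ u ∧ u + 1 < 2 * s) ∨ u + 1 = 2 * s ∨ u = 2 * s + 1 := by omega
    rcases hcases with h | h | h | h | h | h | h | h
    · exact ⟨2, .inl ⟨h, rfl⟩⟩
    · exact ⟨s, .inr (.inl ⟨h.1, h.2, rfl⟩)⟩
    · exact ⟨0, .inr (.inr (.inl ⟨h, rfl⟩))⟩
    · exact ⟨s + 2, .inr (.inr (.inr (.inl ⟨h, rfl⟩)))⟩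
    · exact ⟨2, .inr (.inr (.inr (.inr (.inl ⟨h, rfl⟩))))⟩
    · exact ⟨2 * s - 1, .inr (.inr (.inr (.inr (.inr (.inl ⟨h.1, h.2, by omega⟩)))))⟩
    · exact ⟨s - 1, .inr (.inr (.inr (.inr (.inr (.inr (.inl ⟨h, by omega⟩))))))⟩
    · exact ⟨s + 1, .inr (.inr (.inr (.inr (.inr (.inr (.inr (.inl ⟨h, rfl⟩)))))))⟩
  · obtain ⟨k, c, hc, rfl⟩ : ∃ k c, c < 2 * s ∧ u = 2 * s * k + c :=
      ⟨u / (2 * s), u % (2 * s), Nat.mod_lt _ (by omega), (Nat.div_add_mod _ _).symm⟩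
    have hk : 1 ≤ k := by
      by_contra h0
      obtain rfl : k = 0 := by omega
      omega
    have hkq : k < q := by
      by_contra hkq
      have := Nat.mul_le_mul_left (2 * s) (show q ≤ k by omega)
      omega
    by_cases h1 : c = 1
    · have hk2 : 2 ≤ k := by
        by_contra h0
        obtain rfl : k = 1 := by omega
        omega
      have hprev : 2 * s * (k - 1) + 2 * s = 2 * s * k := by
        rw [← Nat.mul_succ]
        congr 1
        omega
      refine ⟨2 * s * (k - 1) + s + 1, ?_⟩
      unfold Target
      iterate 8 right
      exact ⟨k - 1, by omega, by omega, by omega⟩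
    · have hcases : c = 0 ∨ (2 ≤ c ∧ c < s) ∨ c = s ∨ c = s + 1 ∨ s + 2 ≤ c := by omega
      have block : ∀ d, (_ → Target m s q (2 * s * k + c) d) := fun d h => by
        unfold Target
        iterate 8 right
        exact ⟨k, hk, hkq, h⟩
      rcases hcases with h | h | h | h | h
      · exact ⟨_, block _ (.inl ⟨by omega, rfl⟩)⟩
      · exact ⟨_, block _ (.inr (.inl ⟨by omega, by omega, rfl⟩))⟩
      · exact ⟨_, block _ (.inr (.inr (.inl ⟨by omega, rfl⟩)))⟩
      · exact ⟨_, block _ (.inr (.inr (.inr (.inl ⟨by omega, rfl⟩))))⟩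
      · exact ⟨_, block _ (.inr (.inr (.inr (.inr (.inl ⟨by omega, by omega, rfl⟩)))))⟩

theorem inRow_iff_of_lt {s t n : ℕ} (hn : n < 2 * s) :
    InRow s t n ↔ (t = 0 ∧ (n = 0 ∨ n = 1 ∨ n = 2)) ∨ (t = 1 ∧ (n = 2 ∨ n = 3 ∨ n = s)) ∨
      (t = 2 ∧ (n + 1 = s ∨ n = s ∨ n = s + 1 ∨ n = s + 2)) ∨
      (t = 3 ∧ (n = s + 1 ∨ n = s + 2 ∨ n = s + 3 ∨ n + 1 = 2 * s)) := by
  constructor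
  · rintro (h | h | h | h | ⟨k, hk, h⟩)
    iterate 4 omega
    have := two_mul_le_block (s := s) hk
    omega
  · rintro (h | h | h | h) <;> simp only [InRow, h, true_and, true_or, or_true]

theorem inRow_block_iff {s t k c : ℕ} (hs : 5 ≤ s) (hk : 1 ≤ k) (hc : c < 2 * s) :
    InRow s t (2 * s * k + c) ↔ (t = 3 * k + 1 ∧ (c = 0 ∨ c = 1)) ∨
      (t = 3 * k + 2 ∧ (c = 2 ∨ c = s)) ∨ (t = 3 * k + 3 ∧ (c = s + 1 ∨ c = s + 2)) := by
  have hB := two_mul_le_block (s := s) hk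
  constructor
  · rintro (h | h | h | h | ⟨l, hl, h⟩)
    iterate 4 omega
    rcases block_trichotomy s k l with rfl | h' | h' <;> omega
  · intro h
    unfold InRow
    iterate 4 right
    exact ⟨k, hk, by omega⟩

theorem misses_of_lt {m s u t d : ℕ} (hs : 5 ≤ s) (ht : t ≤ 3) (hd : d < 2 * s) (h1 : InRow s t d)
    (h2 : ¬ Knows m s u d) (h3 : ∀ n < 2 * s, InRow s t n → n ≠ d → Knows m s u n) :
    Misses m s u t d := by
  refine ⟨h1, h2, fun n hn => h3 n ?_ hn⟩
  rcases hn with hn | hn | hn | hn | ⟨k, hk, hn⟩ <;>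
    rcases h1 with h1 | h1 | h1 | h1 | ⟨l, hl, h1⟩ <;> omega

theorem misses_block {m s u k r c : ℕ} (hs : 5 ≤ s) (hk : 1 ≤ k) (hr : 1 ≤ r) (hr3 : r ≤ 3)
    (h1 : InRow s (3 * k + r) (2 * s * k + c)) (h2 : ¬ Knows m s u (2 * s * k + c))
    (h3 : ∀ x < 2 * s, InRow s (3 * k + r) (2 * s * k + x) → x ≠ c →
      Knows m s u (2 * s * k + x)) : Misses m s u (3 * k + r) (2 * s * k + c) := by
  refine ⟨h1, h2, fun n hn hne => ?_⟩
  obtain ⟨x, hx, rfl⟩ : ∃ x < 2 * s, n = 2 * s * k + x := by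
    rcases hn with hn | hn | hn | hn | ⟨l, hl, hn⟩
    iterate 4 omega
    obtain rfl : l = k := by omega
    exact ⟨n - 2 * s * l, by omega, by omega⟩
  exact h3 x hx hn (by omega)

theorem Target.exists_misses {m s q u d : ℕ} (hs : 5 ≤ s) (hq : 2 ≤ q) (hm : m + 1 = 2 * s * q)
    (h : Target m s q u d) : ∃ t ≤ 3 * q, Misses m s u t d := by
  have h2 := block_add_le (s := s) (show 1 < q by omega)
  have special : ∀ t ≤ 3, d < 2 * s → InRow s t d → ¬ Knows m s u d →
      (∀ n < 2 * s, InRow s t n → n ≠ d → Knows m s u n) → ∃ t ≤ 3 * q, Misses m s u t d :=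
    fun t ht hd h1 h2 h3 => ⟨t, by omega, misses_of_lt hs ht hd h1 h2 h3⟩
  rcases h with h | h | h | h | h | h | h | h | ⟨k, hk, hkq, h⟩
  on_goal 1 => refine special 0 (by omega) (by omega) ?_ ?_ ?_
  on_goal 4 => refine special 1 (by omega) (by omega) ?_ ?_ ?_
  on_goal 7 => refine special 0 (by omega) (by omega) ?_ ?_ ?_
  on_goal 10 => refine special 2 (by omega) (by omega) ?_ ?_ ?_
  on_goal 13 => refine special 1 (by omega) (by omega) ?_ ?_ ?_
  on_goal 16 => refine special 3 (by omega) (by omega) ?_ ?_ ?_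
  on_goal 19 => refine special 2 (by omega) (by omega) ?_ ?_ ?_
  on_goal 22 => refine special 3 (by omega) (by omega) ?_ ?_ ?_
  iterate 8
    · exact (inRow_iff_of_lt (by omega)).2 (by omega)
    · unfold Knows
      omega
    · intro n hn hr hne
      rw [inRow_iff_of_lt hn] at hr
      unfold Knows
      omega
  have hB := two_mul_le_block (s := s) hk
  have hB' := block_add_le (s := s) hkq
  obtain ⟨r, c, hr, hr3, hc, hrc, rfl, hu⟩ : ∃ r c, 1 ≤ r ∧ r ≤ 3 ∧ c < 2 * s ∧
      ((r = 1 ∧ (c = 0 ∨ c = 1)) ∨ (r = 2 ∧ (c = 2 ∨ c = s)) ∨ (r = 3 ∧ (c = s + 1 ∨ c = s + 2))) ∧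
      d = 2 * s * k + c ∧ ¬ Knows m s u d := by
    unfold Knows
    rcases h with h | h | h | h | h | h | h | h
    · exact ⟨1, 1, by omega⟩
    · exact ⟨2, s, by omega⟩
    · exact ⟨1, 0, by omega⟩
    · exact ⟨3, s + 2, by omega⟩
    · exact ⟨2, 2, by omega⟩
    · exact ⟨2, 2, by omega⟩
    · exact ⟨3, s + 1, by omega⟩
    · exact ⟨3, s + 1, by omega⟩
  refine ⟨3 * k + r, by omega, misses_block hs hk hr hr3 ?_ hu fun x hx hrx hne => ?_⟩
  · exact (inRow_block_iff hs hk hc).2 (by omega)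
  · rw [inRow_block_iff hs hk hx] at hrx
    clear hu
    unfold Knows
    rcases h with h | h | h | h | h | h | h | h <;> omega

theorem isCheck_nil {m s u n : ℕ} (h : ∀ t, ¬ InRow s t n) : IsCheck m s u n [] := by
  simp [IsCheck, h]

theorem isCheck_pair {m s u n : ℕ} (x : ℕ) (hx : x < m) (hxn : x ≠ n) (hxu : ¬ Knows m s u x)
    (h : ∀ t, InRow s t n ↔ InRow s t x) : IsCheck m s u n [x] := by
  refine ⟨by simp [hx, hxn, hxu], fun t => ?_⟩
  by_cases hc : InRow s t x <;> simp [h t, hc]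
  decide

theorem isCheck_triple {m s u n : ℕ} (x y : ℕ) (hx : x < m) (hxn : x ≠ n) (hxu : ¬ Knows m s u x)
    (hy : y < m) (hyn : y ≠ n) (hyu : ¬ Knows m s u y)
    (h : ∀ t, ¬ (InRow s t n ↔ (InRow s t x ↔ InRow s t y))) : IsCheck m s u n [x, y] := by
  refine ⟨by simp [hx, hxn, hxu, hy, hyn, hyu], fun t => ?_⟩
  have ht := h t
  by_cases hcx : InRow s t x <;> by_cases hcy : InRow s t y <;>
    simp only [hcx, hcy, iff_true, iff_false, not_not, not_true] at ht <;>
    simp [ht, hcx, hcy] <;> decide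

/-- Up to the choice of the block, the relation `Target` is linear. -/
theorem Target.exists_block {m s q u d : ℕ} (hq : 2 ≤ q) (h : Target m s q u d) :
    ∃ k, 1 ≤ k ∧ k < q ∧ ((u = 1 ∧ d = 2) ∨ (3 ≤ u ∧ u < s ∧ d = s) ∨ (u = s ∧ d = 0) ∨
      (u = s + 1 ∧ d = s + 2) ∨ (u = s + 2 ∧ d = 2) ∨
      (s + 3 ≤ u ∧ u + 1 < 2 * s ∧ d + 1 = 2 * s) ∨ (u + 1 = 2 * s ∧ d + 1 = s) ∨
      (u = 2 * s + 1 ∧ d = s + 1 ∧ 2 * s * k = 2 * s) ∨ (u = 2 * s * k ∧ d = 2 * s * k + 1) ∨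
      (2 * s * k + 2 ≤ u ∧ u < 2 * s * k + s ∧ d = 2 * s * k + s) ∨
      (u = 2 * s * k + s ∧ d = 2 * s * k) ∨
      (u = 2 * s * k + s + 1 ∧ d = 2 * s * k + s + 2) ∨
      (2 * s * k + s + 2 ≤ u ∧ u < 2 * s * k + 2 * s ∧ d = 2 * s * k + 2) ∨
      (u = 0 ∧ 2 * s * k + 2 * s = m + 1 ∧ d = 2 * s * k + 2) ∨
      (u = 2 * s * k + 2 * s + 1 ∧ d = 2 * s * k + s + 1) ∨
      (u = 2 ∧ 2 * s * k + 2 * s = m + 1 ∧ d = 2 * s * k + s + 1)) := by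
  rcases h with h | h | h | h | h | h | h | h | ⟨k, hk, hkq, h⟩
  iterate 8 exact ⟨1, le_rfl, hq, by simp only [h, mul_one, true_and, true_or, or_true]⟩
  exact ⟨k, hk, hkq, by simp only [h, or_true]⟩

set_option maxHeartbeats 1000000 in
theorem Target.exists_isCheck_of_lt {m s q u d n : ℕ} (hs : 5 ≤ s) (hq : 2 ≤ q)
    (hm : m + 1 = 2 * s * q) (hu : u < m) (h : Target m s q u d) (hn : n < 2 * s)
    (hnu : ¬ Knows m s u n) (hnd : n ≠ d) : ∃ L, IsCheck m s u n L := by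
  have h2 := block_add_le (s := s) (show 1 < q by omega)
  obtain ⟨k, hk, hkq, h⟩ := h.exists_block hq
  have hB := block_lt_cases (s := s) hk
  have hB' := block_lt_cases (s := s) hkq
  have pair : ∀ x < 2 * s, x ≠ n → ¬ Knows m s u x →
      (∀ t, InRow s t n ↔ InRow s t x) → ∃ L, IsCheck m s u n L :=
    fun x hx hxn hxu hrow => ⟨_, isCheck_pair x (by omega) hxn hxu hrow⟩
  have triple : ∀ x < 2 * s, ∀ y < 2 * s, x ≠ n → y ≠ n → ¬ Knows m s u x → ¬ Knows m s u y →
      (∀ t, ¬ (InRow s t n ↔ (InRow s t x ↔ InRow s t y))) → ∃ L, IsCheck m s u n L :=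
    fun x hx y hy hxn hyn hxu hyu hrow =>
      ⟨_, isCheck_triple x y (by omega) hxn hxu (by omega) hyn hyu hrow⟩
  by_cases hused : n = 0 ∨ n = 1 ∨ n = 2 ∨ n = 3 ∨ n + 1 = s ∨ n = s ∨ n = s + 1 ∨ n = s + 2 ∨
      n = s + 3 ∨ n + 1 = 2 * s
  swap
  · refine ⟨_, isCheck_nil fun t => ?_⟩
    rw [inRow_iff_of_lt hn]
    omega
  have unknown : ∀ x, (n = 0 ∧ x = 1) ∨ (n = 2 ∧ (x = 1 ∨ x = 3)) ∨ (n = s ∧ (x = 3 ∨ x + 1 = s)) ∨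
      (n = s + 1 ∧ x = s + 2) ∨ (n = s + 2 ∧ x = s + 1) ∨ (n + 1 = 2 * s ∧ x = s + 3) →
      ¬ Knows m s u x := by
    intro x hx
    clear hused pair triple
    unfold Knows at hnu ⊢
    rcases h with h | h | h | h | h | h | h | h | h | h | h | h | h | h | h | h <;> omega
  have unknown_of_eq_one : n = 1 → ¬ Knows m s u 0 ∨ (¬ Knows m s u 2 ∧ ¬ Knows m s u 3) := by
    clear hused pair triple unknown
    unfold Knows at hnu ⊢
    rcases h with h | h | h | h | h | h | h | h | h | h | h | h | h | h | h | h <;> omega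
  have unknown_of_eq_three : n = 3 → (¬ Knows m s u 1 ∧ ¬ Knows m s u 2) ∨
      (¬ Knows m s u (s - 1) ∧ ¬ Knows m s u s) := by
    clear hused pair triple unknown
    unfold Knows at hnu ⊢
    rcases h with h | h | h | h | h | h | h | h | h | h | h | h | h | h | h | h <;> omega
  have unknown_of_succ_eq : n + 1 = s → (¬ Knows m s u 3 ∧ ¬ Knows m s u s) ∨
      (¬ Knows m s u (s + 1) ∧ ¬ Knows m s u (s + 3)) := by
    clear hused pair triple unknown
    unfold Knows at hnu ⊢
    rcases h with h | h | h | h | h | h | h | h | h | h | h | h | h | h | h | h <;> omega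
  have unknown_of_eq_add_three : n = s + 3 → ¬ Knows m s u (2 * s - 1) ∨
      (¬ Knows m s u (s - 1) ∧ ¬ Knows m s u (s + 1)) := by
    clear hused pair triple unknown
    unfold Knows at hnu ⊢
    rcases h with h | h | h | h | h | h | h | h | h | h | h | h | h | h | h | h <;> omega
  clear h hB hB' hnu
  have hrows : ∀ t, t = 0 ∨ t = 1 ∨ t = 2 ∨ t = 3 ∨ 4 ≤ t := by omega
  have pairRow : ∀ x < 2 * s, ((n = 0 ∧ x = 1) ∨ (n = 1 ∧ x = 0) ∨ (n = s + 1 ∧ x = s + 2) ∨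
      (n = s + 2 ∧ x = s + 1) ∨ (n = s + 3 ∧ x + 1 = 2 * s) ∨ (n + 1 = 2 * s ∧ x = s + 3)) →
      ¬ Knows m s u x → ∃ L, IsCheck m s u n L := by
    intro x hx hnx hxu
    refine pair x hx (by omega) hxu fun t => ?_
    clear hused hxu
    rw [inRow_iff_of_lt hx, inRow_iff_of_lt hn]
    rcases hrows t with rfl | rfl | rfl | rfl | ht <;> (try simp) <;> omega
  have tripleRow : ∀ x < 2 * s, ∀ y < 2 * s, ((n = 1 ∧ x = 2 ∧ y = 3) ∨ (n = 2 ∧ x = 1 ∧ y = 3) ∨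
      (n = 3 ∧ x = 1 ∧ y = 2) ∨ (n = 3 ∧ x + 1 = s ∧ y = s) ∨ (n + 1 = s ∧ x = 3 ∧ y = s) ∨
      (n = s ∧ x = 3 ∧ y + 1 = s) ∨ (n + 1 = s ∧ x = s + 1 ∧ y = s + 3) ∨
      (n = s + 3 ∧ x + 1 = s ∧ y = s + 1)) →
      ¬ Knows m s u x → ¬ Knows m s u y → ∃ L, IsCheck m s u n L := by
    intro x hx y hy hnxy hxu hyu
    refine triple x hx y hy (by omega) (by omega) hxu hyu fun t => ?_
    clear hused hxu hyu
    rw [inRow_iff_of_lt hx, inRow_iff_of_lt hy, inRow_iff_of_lt hn]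
    rcases hrows t with rfl | rfl | rfl | rfl | ht <;> (try simp) <;>
      rcases hnxy with h | h | h | h | h | h | h | h <;> omega
  rcases hused with h' | h' | h' | h' | h' | h' | h' | h' | h' | h'
  · exact pairRow 1 (by omega) (by omega) (unknown _ (by omega))
  · rcases unknown_of_eq_one h' with hk | hk
    · exact pairRow 0 (by omega) (by omega) hk
    · exact tripleRow 2 (by omega) 3 (by omega) (.inl ⟨h', rfl, rfl⟩) hk.1 hk.2
  · exact tripleRow 1 (by omega) 3 (by omega) (.inr (.inl ⟨h', rfl, rfl⟩))
      (unknown _ (by omega)) (unknown _ (by omega))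
  · rcases unknown_of_eq_three h' with hk | hk
    · exact tripleRow 1 (by omega) 2 (by omega) (.inr (.inr (.inl ⟨h', rfl, rfl⟩))) hk.1 hk.2
    · exact tripleRow (s - 1) (by omega) s (by omega)
        (.inr (.inr (.inr (.inl ⟨h', by omega, rfl⟩))))
        hk.1 hk.2
  · rcases unknown_of_succ_eq h' with hk | hk
    · exact tripleRow 3 (by omega) s (by omega) (.inr (.inr (.inr (.inr (.inl ⟨h', rfl, rfl⟩)))))
        hk.1 hk.2
    · exact tripleRow (s + 1) (by omega) (s + 3) (by omega)
        (.inr (.inr (.inr (.inr (.inr (.inr (.inl ⟨h', rfl, rfl⟩)))))))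
        hk.1 hk.2
  · exact tripleRow 3 (by omega) (s - 1) (by omega)
      (.inr (.inr (.inr (.inr (.inr (.inl ⟨h', rfl, by omega⟩))))))
      (unknown _ (by omega))
      (unknown _ (by omega))
  · exact pairRow (s + 2) (by omega) (by omega) (unknown _ (by omega))
  · exact pairRow (s + 1) (by omega) (by omega) (unknown _ (by omega))
  · rcases unknown_of_eq_add_three h' with hk | hk
    · exact pairRow (2 * s - 1) (by omega) (by omega) hk
    · exact tripleRow (s - 1) (by omega) (s + 1) (by omega)
        (.inr (.inr (.inr (.inr (.inr (.inr (.inr ⟨h', by omega, rfl⟩)))))))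
        hk.1 hk.2
  · exact pairRow (s + 3) (by omega) (by omega) (unknown _ (by omega))

set_option maxHeartbeats 400000 in
theorem Target.exists_isCheck_block {m s q u d l c : ℕ} (hs : 5 ≤ s) (hq : 2 ≤ q)
    (hm : m + 1 = 2 * s * q) (hu : u < m) (h : Target m s q u d) (hl : 1 ≤ l) (hlq : l < q)
    (hc : c < 2 * s) (hnu : ¬ Knows m s u (2 * s * l + c))
    (hnd : 2 * s * l + c ≠ d) : ∃ L, IsCheck m s u (2 * s * l + c) L := by
  have hB := two_mul_le_block (s := s) hl
  have hB' := block_add_le (s := s) hlq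
  by_cases hused : c = 0 ∨ c = 1 ∨ c = 2 ∨ c = s ∨ c = s + 1 ∨ c = s + 2
  · obtain ⟨p, hp, hpm, hpc, hcp⟩ : ∃ p < 2 * s, 2 * s * l + p < m ∧ p ≠ c ∧
        ((c = 0 ∧ p = 1) ∨ (c = 1 ∧ p = 0) ∨ (c = 2 ∧ p = s) ∨ (c = s ∧ p = 2) ∨
          (c = s + 1 ∧ p = s + 2) ∨ (c = s + 2 ∧ p = s + 1)) := by
      rcases hused with h | h | h | h | h | h
      · exact ⟨1, by omega⟩
      · exact ⟨0, by omega⟩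
      · exact ⟨s, by omega⟩
      · exact ⟨2, by omega⟩
      · exact ⟨s + 2, by omega⟩
      · exact ⟨s + 1, by omega⟩
    refine ⟨_, isCheck_pair (2 * s * l + p) hpm (by omega) ?_ fun t => ?_⟩
    · obtain ⟨k, hk, hkq, h⟩ := h.exists_block hq
      have hC := two_mul_le_block (s := s) hk
      have hC' := block_add_le (s := s) hkq
      unfold Knows at hnu ⊢
      clear hused
      rcases h with h | h | h | h | h | h | h | h | h
      iterate 8
        rcases hcp with hcp | hcp | hcp | hcp | hcp | hcp <;>
        first
        | omega
        | have := block_lt_cases (s := s) hlq; omega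
        | have := block_lt_cases (s := s) hl; omega
      rcases lt_trichotomy k l with hkl | rfl | hkl
      on_goal 1 => have hkl' := block_add_le (s := s) hkl
      on_goal 3 => have hkl' := block_add_le (s := s) hkl
      all_goals
        rcases h with h | h | h | h | h | h | h | h <;>
        rcases hcp with hcp | hcp | hcp | hcp | hcp | hcp <;>
        first
        | omega
        | have := block_lt_cases (s := s) hkl; omega
    · rw [inRow_block_iff hs hl hp, inRow_block_iff hs hl hc]
      omega
  · refine ⟨_, isCheck_nil fun t => ?_⟩
    rw [inRow_block_iff hs hl hc]
    omega

theorem Target.exists_isCheck {m s q u d n : ℕ} (hs : 5 ≤ s) (hq : 2 ≤ q) (hm : m + 1 = 2 * s * q)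
    (hu : u < m) (h : Target m s q u d) (hn : n < m) (hnu : ¬ Knows m s u n) (hnd : n ≠ d) :
    ∃ L, IsCheck m s u n L := by
  by_cases hn2 : n < 2 * s
  · exact h.exists_isCheck_of_lt hs hq hm hu hn2 hnu hnd
  · obtain ⟨l, c, hc, rfl⟩ : ∃ l c, c < 2 * s ∧ n = 2 * s * l + c :=
      ⟨n / (2 * s), n % (2 * s), Nat.mod_lt _ (by omega), (Nat.div_add_mod _ _).symm⟩
    have hl : 1 ≤ l := by
      by_contra h0
      obtain rfl : l = 0 := by omega
      omega
    have hlq : l < q := by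
      by_contra hlq
      have := Nat.mul_le_mul_left (2 * s) (show q ≤ l by omega)
      omega
    exact h.exists_isCheck_block hs hq hm hu hl hlq hc hnu hnd

theorem blockCode_decentralized {m s q : ℕ} [NeZero m] (hs : 5 ≤ s) (hq : 2 ≤ q)
    (hm : m + 1 = 2 * s * q) {ℓ : ℕ} (hℓ : ℓ = 3 * q + 1) :
    IsDecentralizedCode m s (blockCode m s ℓ) := by
  have h2 := block_add_le (s := s) (show 1 < q by omega)
  intro t
  have key : ∃ u < m, ∀ n, InRow s t n → Knows m s u n := by
    by_cases h4 : (t : ℕ) < 4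
    · refine ⟨if (t : ℕ) = 0 then 2 else if (t : ℕ) = 1 then s else
        if (t : ℕ) = 2 then s + 2 else 2 * s - 1, by split_ifs <;> omega, ?_⟩
      rintro n (h | h | h | h | ⟨k, hk, h⟩) <;> unfold Knows <;> split_ifs <;> omega
    · obtain ⟨k, r, hk, hr, htk⟩ : ∃ k r, 1 ≤ k ∧ r < 3 ∧ (t : ℕ) = 3 * k + 1 + r :=
        ⟨(t - 1) / 3, (t - 1) % 3, by omega, by omega, by omega⟩
      have hkq := block_add_le (s := s) (show k < q by omega)
      refine ⟨2 * s * k + if r = 0 then 1 else if r = 1 then s else s + 2,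
        by split_ifs <;> omega, ?_⟩
      rintro n (h | h | h | h | ⟨l, hl, h⟩)
      iterate 4 omega
      obtain rfl : l = k := by omega
      unfold Knows
      split_ifs <;> omega
  obtain ⟨u, hu, h⟩ := key
  refine ⟨(u : ZMod m), fun j hj => ?_⟩
  rw [mem_sideInfo_iff (by omega), ZMod.val_natCast_of_lt hu]
  refine h _ ?_
  by_contra hc
  exact hj (if_neg hc)

theorem blockCode_mem_decSet {m s q : ℕ} [NeZero m] (hs : 5 ≤ s) (hq : 2 ≤ q)
    (hm : m + 1 = 2 * s * q) {ℓ : ℕ} (hℓ : ℓ = 3 * q + 1) {i : ZMod m} {t d : ℕ}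
    (ht : t ≤ 3 * q) (hd : Misses m s i.val t d) :
    (d : ZMod m) ∈ decSet m s (blockCode m s ℓ) i := by
  have h2 := block_add_le (s := s) (show 1 < q by omega)
  have hdm := hd.1.lt_of_le hs hq hm ht
  refine mem_decSet_of_row ?_ ⟨t, by omega⟩ (if_pos ?_) fun k hk hkd => if_neg fun hc => ?_
  · rw [mem_sideInfo_iff (by omega), ZMod.val_natCast_of_lt hdm]
    exact hd.2.1
  · rw [ZMod.val_natCast_of_lt hdm]
    exact hd.1
  · rw [mem_sideInfo_iff (by omega)] at hk
    refine hk (hd.2.2 _ hc ?_)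
    rintro rfl
    exact hkd (ZMod.natCast_zmod_val k).symm

theorem eq_of_mem_decSet_blockCode {m s q : ℕ} [NeZero m] (hs : 5 ≤ s) (hq : 2 ≤ q)
    (hm : m + 1 = 2 * s * q) {ℓ : ℕ} {i j : ZMod m} {d : ℕ}
    (hd : Target m s q i.val d) (hj : j ∈ decSet m s (blockCode m s ℓ) i) :
    j = d := by
  have h2 := block_add_le (s := s) (show 1 < q by omega)
  by_contra hne
  have hju := hj.1
  rw [mem_sideInfo_iff (by omega)] at hju
  obtain ⟨L, hL, hrow⟩ := hd.exists_isCheck hs hq hm (ZMod.val_lt i) (ZMod.val_lt j) hju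
    (by rintro rfl; exact hne (ZMod.natCast_zmod_val j).symm)
  let h : (ZMod m → ZMod 2) →ₗ[ZMod 2] ZMod 2 :=
    ((j.val :: L).map fun x : ℕ => LinearMap.proj (R := ZMod 2) (φ := fun _ : ZMod m => ZMod 2)
      (x : ZMod m)).sum
  have happ : ∀ v, h v = ((j.val :: L).map fun x : ℕ => v (x : ZMod m)).sum := by
    intro v
    have := map_list_sum (LinearMap.applyₗ (R := ZMod 2) (M₂ := ZMod 2) v)
      ((j.val :: L).map fun x : ℕ => LinearMap.proj (R := ZMod 2) (φ := fun _ : ZMod m => ZMod 2)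
      (x : ZMod m))
    rw [List.map_map] at this
    exact this
  have hval : ∀ x ∈ j.val :: L, (x : ZMod m).val = x := by
    intro x hx
    rcases List.mem_cons.1 hx with rfl | hx
    · rw [ZMod.natCast_zmod_val]
    · exact ZMod.val_natCast_of_lt (hL x hx).1
  refine notMem_span_of_functional h (fun t => ?_) (fun k hk => ?_) ?_ hj
  · rw [happ, ← hrow t]
    congr 1
    refine List.map_congr_left fun x hx => ?_
    unfold blockCode
    rw [hval x hx]
  · rw [happ]
    refine List.sum_eq_zero fun y hy => ?_
    obtain ⟨x, hx, rfl⟩ := List.mem_map.1 hy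
    refine Pi.single_eq_of_ne ?_ _
    rintro rfl
    rw [mem_sideInfo_iff (by omega), hval x hx] at hk
    rcases List.mem_cons.1 hx with rfl | hx
    · exact hju hk
    · exact (hL x hx).2.2 hk
  · rw [happ, List.map_cons, List.sum_cons, ZMod.natCast_zmod_val, Pi.single_eq_same,
      List.sum_eq_zero, add_zero]
    · exact one_ne_zero
    · intro y hy
      obtain ⟨x, hx, rfl⟩ := List.mem_map.1 hy
      refine Pi.single_eq_of_ne ?_ _
      intro hxj
      refine (hL x hx).2.1 ?_
      rw [← hxj, hval x (List.mem_cons_of_mem _ hx)]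

end SDPicod

theorem feasible_mod_two_s_sub_one (m s : ℕ) (hs : 5 ≤ s) (hm : 2 * s < m)
    (hmod : m % (2 * s) = 2 * s - 1) :
    ∃ G : Fin (3 * (m + 1) / (2 * s) + 1) → ZMod m → ZMod 2,
      IsDecentralizedCode m s G ∧ Correct m s G ∧ Secure m s G := by
  have : NeZero m := ⟨by omega⟩
  obtain ⟨q, hq⟩ : ∃ q, m + 1 = 2 * s * q := by
    refine ⟨m / (2 * s) + 1, ?_⟩
    have := Nat.div_add_mod m (2 * s)
    rw [Nat.mul_succ]
    omega
  have hq2 : 2 ≤ q := by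
    by_contra hlt
    have := Nat.mul_le_mul_left (2 * s) (show q ≤ 1 by omega)
    omega
  have hℓ : 3 * (m + 1) / (2 * s) + 1 = 3 * q + 1 := by
    rw [hq, Nat.mul_left_comm, Nat.mul_div_cancel_left _ (by omega)]
  refine ⟨blockCode m s _, blockCode_decentralized hs hq2 hq hℓ, fun i => ?_, fun i => ?_⟩
  · obtain ⟨d, hd⟩ := exists_target hs hq2 hq (ZMod.val_lt i)
    obtain ⟨t, ht, htd⟩ := hd.exists_misses hs hq2 hq
    exact ⟨_, blockCode_mem_decSet hs hq2 hq hℓ ht htd⟩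
  · obtain ⟨d, hd⟩ := exists_target hs hq2 hq (ZMod.val_lt i)
    intro j hj k hk
    rw [eq_of_mem_decSet_blockCode hs hq2 hq hd hj, eq_of_mem_decSet_blockCode hs hq2 hq hd hk]
end

section
/- For all integers m, s with s ≥ 5, s + 4 ≤ m, 2·m ≤ 3·s, and (m − s) not dividing m, there exist a length ℓ ≤ 4 and a decentralized linear code of length ℓ for parameters (m, s) that is both correct and secure. -/
namespace SDPicod

/-- Exactly one point of the window `[a, a + d)` satisfies `P`. -/
def OnceIn (d : ℕ) (P : ℕ → Prop) (a : ℕ) : Prop :=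
  ∃! x, (a ≤ x ∧ x < a + d) ∧ P x

/-- A labelling of `[0, m + d)`, compatible with reduction modulo `m`, in which every window of
length `d` contains exactly one of the labels `1, 2, 3` exactly once, and each of these labels is
missing from some window. -/
structure GoodWord (d m : ℕ) (F : ℕ → ℕ) : Prop where
  wrap : ∀ j < d, F (j + m) = F j
  once : ∀ a < m, ∃! l, (1 ≤ l ∧ l ≤ 3) ∧ OnceIn d (fun x => F x = l) a
  avoid : ∀ l, 1 ≤ l → l ≤ 3 → ∃ a < m, ∀ x, a ≤ x → x < a + d → F x ≠ l

lemma onceIn_congr {d a b : ℕ} {P Q : ℕ → Prop} (h : ∀ k < d, (P (a + k) ↔ Q (b + k))) :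
    OnceIn d P a ↔ OnceIn d Q b := by
  have key : ∀ {a b : ℕ} {P Q : ℕ → Prop}, (∀ k < d, (P (a + k) ↔ Q (b + k))) →
      OnceIn d P a → OnceIn d Q b := by
    intro a b P Q h ⟨x, ⟨⟨hx1, hx2⟩, hx⟩, hu⟩
    refine ⟨b + (x - a), ⟨⟨by omega, by omega⟩, ?_⟩, ?_⟩
    · rw [← h _ (by omega)]
      rwa [show a + (x - a) = x by omega]
    · rintro y ⟨⟨hy1, hy2⟩, hy⟩
      have := hu (a + (y - b)) ⟨⟨by omega, by omega⟩, by
        rw [h _ (by omega)]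
        rwa [show b + (y - b) = y by omega]⟩
      omega
  exact ⟨key h, key fun k hk => (h k hk).symm⟩

/-- In a sequence with period `d` the number of occurrences in a window does not depend on the
window. -/
lemma onceIn_periodic {d a : ℕ} {P : ℕ → Prop} (ha : a ≤ d)
    (h : ∀ x < d, (P (x + d) ↔ P x)) : OnceIn d P a ↔ OnceIn d P 0 := by
  constructor
  · rintro ⟨x, ⟨⟨hx1, hx2⟩, hx⟩, hu⟩
    rcases lt_or_ge x d with hxd | hxd
    · refine ⟨x, ⟨⟨by omega, by omega⟩, hx⟩, ?_⟩
      rintro y ⟨⟨hy1, hy2⟩, hy⟩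
      rcases lt_or_ge y a with hya | hya
      · have := hu (y + d) ⟨⟨by omega, by omega⟩, (h y (by omega)).2 hy⟩
        omega
      · exact hu y ⟨⟨hya, by omega⟩, hy⟩
    · obtain ⟨z, rfl⟩ := Nat.exists_eq_add_of_le' hxd
      refine ⟨z, ⟨⟨by omega, by omega⟩, (h z (by omega)).1 hx⟩, ?_⟩
      rintro y ⟨⟨hy1, hy2⟩, hy⟩
      rcases lt_or_ge y a with hya | hya
      · have := hu (y + d) ⟨⟨by omega, by omega⟩, (h y (by omega)).2 hy⟩
        omega
      · have := hu y ⟨⟨hya, by omega⟩, hy⟩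
        omega
  · rintro ⟨x, ⟨⟨hx1, hx2⟩, hx⟩, hu⟩
    have hu' : ∀ y, a ≤ y → y < a + d → P y → y = x ∨ y = x + d := by
      intro y hy1 hy2 hy
      rcases lt_or_ge y d with hyd | hyd
      · exact Or.inl (hu y ⟨⟨by omega, by omega⟩, hy⟩)
      · obtain ⟨z, rfl⟩ := Nat.exists_eq_add_of_le' hyd
        have := hu z ⟨⟨by omega, by omega⟩, (h z (by omega)).1 hy⟩
        omega
    rcases lt_or_ge x a with hxa | hxa
    · refine ⟨x + d, ⟨⟨by omega, by omega⟩, (h x (by omega)).2 hx⟩, ?_⟩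
      rintro y ⟨⟨hy1, hy2⟩, hy⟩
      rcases hu' y hy1 hy2 hy with rfl | rfl <;> omega
    · refine ⟨x, ⟨⟨by omega, by omega⟩, hx⟩, ?_⟩
      rintro y ⟨⟨hy1, hy2⟩, hy⟩
      rcases hu' y hy1 hy2 hy with rfl | rfl <;> omega

/-- Repeating the first window of a good word gives a good word. -/
lemma GoodWord.extend {d m : ℕ} {F : ℕ → ℕ} (h : GoodWord d m F) (hm : 0 < m) :
    GoodWord d (m + d) (fun j => if j < d then F j else F (j - d)) := by
  refine ⟨?_, ?_, ?_⟩
  · intro j hj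
    simp only [hj, if_true]
    rw [if_neg (by omega), show j + (m + d) - d = j + m by omega, h.wrap j hj]
  · have shift : ∀ b, b < m → ∀ l,
        (OnceIn d (fun x => (if x < d then F x else F (x - d)) = l) (b + d) ↔
          OnceIn d (fun x => F x = l) b) := by
      intro b hb l
      apply onceIn_congr
      intro k hk
      rw [if_neg (by omega), show b + d + k - d = b + k by omega]
    intro a ha
    rcases lt_or_ge a d with had | had
    · have heq : ∀ l, OnceIn d (fun x => (if x < d then F x else F (x - d)) = l) a ↔
          OnceIn d (fun x => F x = l) 0 := by
        intro l
        rw [← shift 0 hm l, zero_add,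
          onceIn_periodic had.le, ← onceIn_periodic (a := d) le_rfl] <;>
        · intro x hx
          simp only [hx, if_true]
          rw [if_neg (by omega), show x + d - d = x by omega]
      simp only [heq]
      exact h.once 0 hm
    · obtain ⟨b, rfl⟩ := Nat.exists_eq_add_of_le' had
      simp only [shift b (by omega)]
      exact h.once b (by omega)
  · intro l hl1 hl3
    obtain ⟨a, ha, hav⟩ := h.avoid l hl1 hl3
    refine ⟨a + d, by omega, fun x hx1 hx2 => ?_⟩
    rw [if_neg (by omega)]
    exact hav _ (by omega) (by omega)

lemma exists_goodWord_add_mul {d m : ℕ} (hm : 0 < m) (h : ∃ F, GoodWord d m F) (n : ℕ) :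
    ∃ F, GoodWord d (m + n * d) F := by
  induction n with
  | zero => simpa using h
  | succ n ih =>
    obtain ⟨F, hF⟩ := ih
    have := hF.extend (by omega)
    rw [show m + n * d + d = m + (n + 1) * d by ring] at this
    exact ⟨_, this⟩

/-- A window contains exactly one point of an increasing six-element set iff it contains some
point of the set and neither of its neighbours. -/
lemma onceIn_iff {d a p₀ p₁ p₂ p₃ p₄ p₅ : ℕ} (h₁ : p₀ < p₁) (h₂ : p₁ < p₂) (h₃ : p₂ < p₃)
    (h₄ : p₃ < p₄) (h₅ : p₄ < p₅) :
    OnceIn d (fun x => x = p₀ ∨ x = p₁ ∨ x = p₂ ∨ x = p₃ ∨ x = p₄ ∨ x = p₅) a ↔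
      (a ≤ p₀ ∧ p₀ < a + d ∧ a + d ≤ p₁) ∨
      (p₀ < a ∧ a ≤ p₁ ∧ p₁ < a + d ∧ a + d ≤ p₂) ∨
      (p₁ < a ∧ a ≤ p₂ ∧ p₂ < a + d ∧ a + d ≤ p₃) ∨
      (p₂ < a ∧ a ≤ p₃ ∧ p₃ < a + d ∧ a + d ≤ p₄) ∨
      (p₃ < a ∧ a ≤ p₄ ∧ p₄ < a + d ∧ a + d ≤ p₅) ∨
      (p₄ < a ∧ a ≤ p₅ ∧ p₅ < a + d) := by
  constructor
  · rintro ⟨x, ⟨⟨hx1, hx2⟩, hx⟩, hu⟩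
    have u₀ := fun h => hu p₀ ⟨h, .inl rfl⟩
    have u₁ := fun h => hu p₁ ⟨h, .inr <| .inl rfl⟩
    have u₂ := fun h => hu p₂ ⟨h, .inr <| .inr <| .inl rfl⟩
    have u₃ := fun h => hu p₃ ⟨h, .inr <| .inr <| .inr <| .inl rfl⟩
    have u₄ := fun h => hu p₄ ⟨h, .inr <| .inr <| .inr <| .inr <| .inl rfl⟩
    have u₅ := fun h => hu p₅ ⟨h, .inr <| .inr <| .inr <| .inr <| .inr rfl⟩
    clear hu
    rcases hx with rfl | rfl | rfl | rfl | rfl | rfl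
    · exact .inl (by omega)
    · exact .inr (.inl (by omega))
    · exact .inr (.inr (.inl (by omega)))
    · exact .inr (.inr (.inr (.inl (by omega))))
    · exact .inr (.inr (.inr (.inr (.inl (by omega)))))
    · exact .inr (.inr (.inr (.inr (.inr (by omega)))))
  · rintro (h | h | h | h | h | h)
    · exact ⟨p₀, ⟨by omega, .inl rfl⟩, fun y ⟨_, _⟩ => by omega⟩
    · exact ⟨p₁, ⟨by omega, .inr <| .inl rfl⟩, fun y ⟨_, _⟩ => by omega⟩
    · exact ⟨p₂, ⟨by omega, .inr <| .inr <| .inl rfl⟩, fun y ⟨_, _⟩ => by omega⟩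
    · exact ⟨p₃, ⟨by omega, .inr <| .inr <| .inr <| .inl rfl⟩, fun y ⟨_, _⟩ => by omega⟩
    · exact ⟨p₄, ⟨by omega, .inr <| .inr <| .inr <| .inr <| .inl rfl⟩, fun y ⟨_, _⟩ => by omega⟩
    · exact ⟨p₅, ⟨by omega, .inr <| .inr <| .inr <| .inr <| .inr rfl⟩, fun y ⟨_, _⟩ => by omega⟩

/-- A good word can be specified by the sets of positions of its three labels. -/
lemma exists_goodWord_of_positions {d m : ℕ} (P Q R : ℕ → Prop)
    (hPQ : ∀ x, P x → ¬ Q x) (hPR : ∀ x, P x → ¬ R x) (hQR : ∀ x, Q x → ¬ R x)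
    (wP : ∀ j < d, (P (j + m) ↔ P j)) (wQ : ∀ j < d, (Q (j + m) ↔ Q j))
    (wR : ∀ j < d, (R (j + m) ↔ R j))
    (once : ∀ a < m,
      (OnceIn d P a ∧ ¬ OnceIn d Q a ∧ ¬ OnceIn d R a) ∨
      (¬ OnceIn d P a ∧ OnceIn d Q a ∧ ¬ OnceIn d R a) ∨
      (¬ OnceIn d P a ∧ ¬ OnceIn d Q a ∧ OnceIn d R a))
    (aP : ∃ a < m, ∀ x, a ≤ x → x < a + d → ¬ P x)
    (aQ : ∃ a < m, ∀ x, a ≤ x → x < a + d → ¬ Q x)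
    (aR : ∃ a < m, ∀ x, a ≤ x → x < a + d → ¬ R x) :
    ∃ F, GoodWord d m F := by
  classical
  let F : ℕ → ℕ := fun x => if P x then 1 else if Q x then 2 else if R x then 3 else 0
  have f1 : ∀ x, (F x = 1 ↔ P x) := fun x => by grind
  have f2 : ∀ x, (F x = 2 ↔ Q x) := fun x => by grind
  have f3 : ∀ x, (F x = 3 ↔ R x) := fun x => by grind
  refine ⟨F, ?_, ?_, ?_⟩
  · intro j hj
    simp only [F, wP j hj, wQ j hj, wR j hj]
  · intro a ha
    have h := once a ha
    rw [← funext fun x => propext (f1 x), ← funext fun x => propext (f2 x),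
      ← funext fun x => propext (f3 x)] at h
    have uniq : ∀ l, (1 ≤ l ∧ l ≤ 3) → l = 1 ∨ l = 2 ∨ l = 3 := by omega
    rcases h with ⟨h1, h2, h3⟩ | ⟨h1, h2, h3⟩ | ⟨h1, h2, h3⟩
    · refine ⟨1, ⟨by norm_num, h1⟩, ?_⟩
      rintro l ⟨hl, ho⟩
      rcases uniq l hl with rfl | rfl | rfl <;> tauto
    · refine ⟨2, ⟨by norm_num, h2⟩, ?_⟩
      rintro l ⟨hl, ho⟩
      rcases uniq l hl with rfl | rfl | rfl <;> tauto
    · refine ⟨3, ⟨by norm_num, h3⟩, ?_⟩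
      rintro l ⟨hl, ho⟩
      rcases uniq l hl with rfl | rfl | rfl <;> tauto
  · intro l hl1 hl3
    obtain rfl | rfl | rfl : l = 1 ∨ l = 2 ∨ l = 3 := by omega
    · simpa only [ne_eq, f1] using aP
    · simpa only [ne_eq, f2] using aQ
    · simpa only [ne_eq, f3] using aR

lemma exists_goodWord_small {r u : ℕ} (hr : 0 < r) :
    ∃ F, GoodWord (3 * r + u) (10 * r + 3 * u) F := by
  apply exists_goodWord_of_positions
    (fun x => x = 0 ∨ x = r + u ∨ x = 3 * r + u ∨ x = 5 * r + 2 * u ∨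
      x = 10 * r + 3 * u ∨ x = 11 * r + 4 * u)
    (fun x => x = 2 * r + u ∨ x = 4 * r + 2 * u ∨ x = 6 * r + 2 * u ∨ x = 7 * r + 2 * u ∨
      x = 12 * r + 4 * u ∨ x = 13 * r + 4 * u)
    (fun x => x = 8 * r + 3 * u ∨ x = 9 * r + 3 * u ∨ x = 13 * r + 4 * u + 1 ∨
      x = 13 * r + 4 * u + 2 ∨ x = 13 * r + 4 * u + 3 ∨ x = 13 * r + 4 * u + 4)
  iterate 6 exact fun x hx => by omega
  · intro a ha
    rw [onceIn_iff (by omega) (by omega) (by omega) (by omega) (by omega),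
      onceIn_iff (by omega) (by omega) (by omega) (by omega) (by omega),
      onceIn_iff (by omega) (by omega) (by omega) (by omega) (by omega)]
    rcases le_or_gt a (r + u) with h0 | h0
    · exact .inr <| .inl ⟨by omega, by omega, by omega⟩
    rcases le_or_gt a (2 * r + u) with h1 | h1
    · exact .inl ⟨by omega, by omega, by omega⟩
    rcases le_or_gt a (3 * r + u) with h2 | h2
    · exact .inr <| .inl ⟨by omega, by omega, by omega⟩
    rcases le_or_gt a (5 * r + 2 * u) with h3 | h3
    · exact .inl ⟨by omega, by omega, by omega⟩
    rcases le_or_gt a (6 * r + 2 * u) with h4 | h4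
    · exact .inr <| .inr ⟨by omega, by omega, by omega⟩
    rcases le_or_gt a (7 * r + 2 * u) with h5 | h5
    · exact .inr <| .inl ⟨by omega, by omega, by omega⟩
    rcases le_or_gt a (8 * r + 3 * u) with h6 | h6
    · exact .inl ⟨by omega, by omega, by omega⟩
    rcases le_or_gt a (9 * r + 3 * u) with h7 | h7
    · exact .inr <| .inr ⟨by omega, by omega, by omega⟩
    exact .inr <| .inl ⟨by omega, by omega, by omega⟩
  · exact ⟨5 * r + 2 * u + 1, by omega, fun x h₁ h₂ => by omega⟩
  · exact ⟨7 * r + 2 * u + 1, by omega, fun x h₁ h₂ => by omega⟩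
  · exact ⟨0, by omega, fun x h₁ h₂ => by omega⟩

lemma exists_goodWord_below_half {r u : ℕ} (hu : 0 < u) (hur : u < r) :
    ∃ F, GoodWord (2 * r + u) (7 * r + 3 * u) F := by
  apply exists_goodWord_of_positions
    (fun x => x = 0 ∨ x = 3 * r + 2 * u ∨ x = 5 * r + 3 * u ∨ x = 6 * r + 3 * u ∨
      x = 7 * r + 3 * u ∨ x = 9 * r + 4 * u)
    (fun x => x = r ∨ x = r + u ∨ x = 8 * r + 3 * u ∨ x = 8 * r + 4 * u ∨
      x = 9 * r + 4 * u + 1 ∨ x = 9 * r + 4 * u + 2)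
    (fun x => x = 2 * r + u ∨ x = 3 * r + u ∨ x = 4 * r + u ∨ x = 4 * r + 2 * u ∨
      x = 6 * r + 2 * u ∨ x = 9 * r + 4 * u + 3)
  iterate 6 exact fun x hx => by omega
  · intro a ha
    rw [onceIn_iff (by omega) (by omega) (by omega) (by omega) (by omega),
      onceIn_iff (by omega) (by omega) (by omega) (by omega) (by omega),
      onceIn_iff (by omega) (by omega) (by omega) (by omega) (by omega)]
    rcases le_or_gt a (0) with h0 | h0
    · exact .inl ⟨by omega, by omega, by omega⟩
    rcases le_or_gt a (r) with h1 | h1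
    · exact .inr <| .inr ⟨by omega, by omega, by omega⟩
    rcases le_or_gt a (r + u) with h2 | h2
    · exact .inr <| .inl ⟨by omega, by omega, by omega⟩
    rcases le_or_gt a (4 * r + 2 * u) with h3 | h3
    · exact .inl ⟨by omega, by omega, by omega⟩
    rcases le_or_gt a (6 * r + 2 * u) with h4 | h4
    · exact .inr <| .inr ⟨by omega, by omega, by omega⟩
    rcases le_or_gt a (6 * r + 3 * u) with h5 | h5
    · exact .inr <| .inl ⟨by omega, by omega, by omega⟩
    exact .inl ⟨by omega, by omega, by omega⟩
  · exact ⟨1, by omega, fun x h₁ h₂ => by omega⟩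
  · exact ⟨r + u + 1, by omega, fun x h₁ h₂ => by omega⟩
  · exact ⟨0, by omega, fun x h₁ h₂ => by omega⟩

lemma exists_goodWord_half {k : ℕ} (hk : 0 < k) :
    ∃ F, GoodWord (2 * k + 2) (7 * k + 7) F := by
  apply exists_goodWord_of_positions
    (fun x => x = 0 ∨ x = k + 1 ∨ x = 2 * k + 2 ∨ x = 3 * k + 3 ∨ x = 7 * k + 7 ∨ x = 8 * k + 8)
    (fun x => x = 2 * k + 1 ∨ x = 5 * k + 5 ∨ x = 9 * k + 8 ∨ x = 9 * k + 9 ∨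
      x = 9 * k + 9 + 1 ∨ x = 9 * k + 9 + 2)
    (fun x => x = 4 * k + 3 ∨ x = 4 * k + 4 ∨ x = 6 * k + 5 ∨ x = 6 * k + 6 ∨
      x = 7 * k + 6 ∨ x = 9 * k + 9 + 3)
  iterate 6 exact fun x hx => by omega
  · intro a ha
    rw [onceIn_iff (by omega) (by omega) (by omega) (by omega) (by omega),
      onceIn_iff (by omega) (by omega) (by omega) (by omega) (by omega),
      onceIn_iff (by omega) (by omega) (by omega) (by omega) (by omega)]
    rcases le_or_gt a (2 * k + 1) with h0 | h0
    · exact .inr <| .inl ⟨by omega, by omega, by omega⟩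
    rcases le_or_gt a (2 * k + 2) with h1 | h1
    · exact .inr <| .inr ⟨by omega, by omega, by omega⟩
    rcases le_or_gt a (3 * k + 3) with h2 | h2
    · exact .inl ⟨by omega, by omega, by omega⟩
    rcases le_or_gt a (5 * k + 5) with h3 | h3
    · exact .inr <| .inl ⟨by omega, by omega, by omega⟩
    rcases le_or_gt a (6 * k + 6) with h4 | h4
    · exact .inl ⟨by omega, by omega, by omega⟩
    exact .inr <| .inr ⟨by omega, by omega, by omega⟩
  · exact ⟨3 * k + 4, by omega, fun x h₁ h₂ => by omega⟩
  · exact ⟨2 * k + 2, by omega, fun x h₁ h₂ => by omega⟩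
  · exact ⟨0, by omega, fun x h₁ h₂ => by omega⟩

lemma exists_goodWord_above_half {v w : ℕ} (hw : 0 < w) (hwv : w ≤ v) :
    ∃ F, GoodWord (2 * v + w) (7 * v + 4 * w) F := by
  apply exists_goodWord_of_positions
    (fun x => x = 0 ∨ x = v + w ∨ x = 5 * v + 2 * w ∨ x = 7 * v + 3 * w ∨
      x = 7 * v + 4 * w ∨ x = 8 * v + 5 * w)
    (fun x => x = v ∨ x = 2 * v + w ∨ x = 3 * v + w ∨ x = 8 * v + 4 * w ∨
      x = 9 * v + 5 * w ∨ x = 9 * v + 5 * w + 1)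
    (fun x => x = 3 * v + 2 * w ∨ x = 4 * v + 2 * w ∨ x = 5 * v + 3 * w ∨ x = 6 * v + 3 * w ∨
      x = 9 * v + 5 * w + 2 ∨ x = 9 * v + 5 * w + 3)
  iterate 6 exact fun x hx => by omega
  · intro a ha
    rw [onceIn_iff (by omega) (by omega) (by omega) (by omega) (by omega),
      onceIn_iff (by omega) (by omega) (by omega) (by omega) (by omega),
      onceIn_iff (by omega) (by omega) (by omega) (by omega) (by omega)]
    rcases le_or_gt a (0) with h0 | h0
    · exact .inr <| .inl ⟨by omega, by omega, by omega⟩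
    rcases le_or_gt a (v + w) with h1 | h1
    · exact .inl ⟨by omega, by omega, by omega⟩
    rcases le_or_gt a (2 * v + w) with h2 | h2
    · exact .inr <| .inr ⟨by omega, by omega, by omega⟩
    rcases le_or_gt a (3 * v + w) with h3 | h3
    · exact .inr <| .inl ⟨by omega, by omega, by omega⟩
    rcases le_or_gt a (5 * v + 3 * w) with h4 | h4
    · exact .inl ⟨by omega, by omega, by omega⟩
    rcases le_or_gt a (6 * v + 3 * w) with h5 | h5
    · exact .inr <| .inr ⟨by omega, by omega, by omega⟩
    exact .inr <| .inl ⟨by omega, by omega, by omega⟩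
  · exact ⟨v + w + 1, by omega, fun x h₁ h₂ => by omega⟩
  · exact ⟨3 * v + w + 1, by omega, fun x h₁ h₂ => by omega⟩
  · exact ⟨0, by omega, fun x h₁ h₂ => by omega⟩

lemma exists_goodWord_large {t u : ℕ} (ht : 0 < t) (hu : 0 < u) :
    ∃ F, GoodWord (3 * t + u) (11 * t + 4 * u) F := by
  apply exists_goodWord_of_positions
    (fun x => x = 0 ∨ x = t + u ∨ x = 3 * t + u ∨ x = 4 * t + 2 * u ∨
      x = 11 * t + 4 * u ∨ x = 12 * t + 5 * u)
    (fun x => x = 2 * t + u ∨ x = 5 * t + 2 * u ∨ x = 6 * t + 2 * u ∨ x = 8 * t + 3 * u ∨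
      x = 13 * t + 5 * u ∨ x = 14 * t + 5 * u)
    (fun x => x = 7 * t + 3 * u ∨ x = 9 * t + 3 * u ∨ x = 9 * t + 4 * u ∨ x = 10 * t + 4 * u ∨
      x = 14 * t + 5 * u + 1 ∨ x = 14 * t + 5 * u + 2)
  iterate 6 exact fun x hx => by omega
  · intro a ha
    rw [onceIn_iff (by omega) (by omega) (by omega) (by omega) (by omega),
      onceIn_iff (by omega) (by omega) (by omega) (by omega) (by omega),
      onceIn_iff (by omega) (by omega) (by omega) (by omega) (by omega)]
    rcases le_or_gt a (3 * t + u) with h0 | h0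
    · exact .inr <| .inl ⟨by omega, by omega, by omega⟩
    rcases le_or_gt a (4 * t + 2 * u) with h1 | h1
    · exact .inl ⟨by omega, by omega, by omega⟩
    rcases le_or_gt a (6 * t + 2 * u) with h2 | h2
    · exact .inr <| .inr ⟨by omega, by omega, by omega⟩
    rcases le_or_gt a (8 * t + 3 * u) with h3 | h3
    · exact .inr <| .inl ⟨by omega, by omega, by omega⟩
    rcases le_or_gt a (9 * t + 4 * u) with h4 | h4
    · exact .inl ⟨by omega, by omega, by omega⟩
    rcases le_or_gt a (10 * t + 4 * u) with h5 | h5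
    · exact .inr <| .inr ⟨by omega, by omega, by omega⟩
    exact .inr <| .inl ⟨by omega, by omega, by omega⟩
  · exact ⟨4 * t + 2 * u + 1, by omega, fun x h₁ h₂ => by omega⟩
  · exact ⟨8 * t + 3 * u + 1, by omega, fun x h₁ h₂ => by omega⟩
  · exact ⟨0, by omega, fun x h₁ h₂ => by omega⟩

lemma exists_goodWord {m d : ℕ} (hd : 4 ≤ d) (hm : 3 * d ≤ m) (hdvd : ¬ d ∣ m) :
    ∃ F, GoodWord d m F := by
  have hr0 : 0 < m % d := Nat.pos_of_ne_zero fun h => hdvd (Nat.dvd_of_mod_eq_zero h)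
  have hrd : m % d < d := Nat.mod_lt _ (by omega)
  have hq : 3 ≤ m / d := (Nat.le_div_iff_mul_le (by omega)).2 hm
  obtain ⟨n, hn⟩ := Nat.exists_eq_add_of_le hq
  have hdm := Nat.div_add_mod m d
  generalize m % d = r at *
  have hm' : m = (3 * d + r) + n * d := by rw [← hdm, hn]; ring
  rw [hm']
  apply exists_goodWord_add_mul (by omega)
  clear hm' hdm hn hq hm hdvd
  rcases le_or_gt (3 * r) d with h | h
  · obtain ⟨u, rfl⟩ := Nat.exists_eq_add_of_le h
    convert exists_goodWord_small (u := u) hr0 using 3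
    omega
  rcases lt_trichotomy (2 * r) d with h' | rfl | h'
  · obtain ⟨u, rfl⟩ := Nat.exists_eq_add_of_le h'.le
    convert exists_goodWord_below_half (r := r) (u := u) (by omega) (by omega) using 3
    omega
  · obtain ⟨k, rfl⟩ : ∃ k, r = k + 1 := ⟨r - 1, by omega⟩
    convert exists_goodWord_half (k := k) (by omega) using 3 <;> omega
  obtain ⟨v, rfl⟩ := Nat.exists_eq_add_of_le hrd.le
  rcases le_or_gt (3 * r) (2 * (r + v)) with h'' | h''
  · obtain ⟨w, rfl⟩ := Nat.exists_eq_add_of_le (show v ≤ r by omega)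
    convert exists_goodWord_above_half (v := v) (w := w) (by omega) (by omega) using 3 <;> omega
  · obtain ⟨u, rfl⟩ := Nat.exists_eq_add_of_le (show 2 * v ≤ r by omega)
    convert exists_goodWord_large (t := v) (u := u) (by omega) (by omega) using 3 <;> omega

/-- The code whose rows are the indicators of the labels `1, 2, 3` of a colouring. -/
def labelCode {m : ℕ} (c : ZMod m → ℕ) : Fin 3 → ZMod m → ZMod 2 :=
  fun t x => if c x = t + 1 then 1 else 0

/-- A user decodes exactly the unknown messages whose label occurs only once among the unknown
messages. -/
lemma mem_decSet_labelCode_iff {m s : ℕ} [NeZero m] (c : ZMod m → ℕ) (i j : ZMod m) :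
    j ∈ decSet m s (labelCode c) i ↔
      j ∉ sideInfo m s i ∧ (1 ≤ c j ∧ c j ≤ 3) ∧ ∀ k ∉ sideInfo m s i, c k = c j → k = j := by
  refine and_congr_right fun hj => ?_
  constructor
  · intro hspan
    have test : ∀ φ : (ZMod m → ZMod 2) →ₗ[ZMod 2] ZMod 2, (∀ t, φ (labelCode c t) = 0) →
        (∀ k ∈ sideInfo m s i, φ (Pi.single k 1) = 0) → φ (Pi.single j 1) = 0 := by
      intro φ h1 h2
      have hle : Submodule.span (ZMod 2) (Set.range (labelCode c) ∪
          {v | ∃ k ∈ sideInfo m s i, v = Pi.single k (1 : ZMod 2)}) ≤ LinearMap.ker φ := by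
        rw [Submodule.span_le]
        rintro v (⟨t, rfl⟩ | ⟨k, hk, rfl⟩)
        · exact h1 t
        · exact h2 k hk
      exact hle hspan
    constructor
    · by_contra hc
      have := test (LinearMap.proj (φ := fun _ => ZMod 2) j) (fun t => ?_) (fun k hk => ?_)
      · simp at this
      · simp only [LinearMap.proj_apply, labelCode]
        rw [if_neg (by omega)]
      · have hkj : j ≠ k := fun h => hj (h ▸ hk)
        simp [hkj]
    · intro k hk hck
      by_contra hkj
      have := test (.proj (φ := fun _ => ZMod 2) j + .proj (φ := fun _ => ZMod 2) k)
        (fun t => ?_) (fun x hx => ?_)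
      · simp [hkj] at this
      · simp only [LinearMap.add_apply, LinearMap.proj_apply, labelCode, hck]
        exact CharTwo.add_self_eq_zero _
      · have h1 : j ≠ x := fun h => hj (h ▸ hx)
        have h2 : k ≠ x := fun h => hk (h ▸ hx)
        simp [h1, h2]
  · rintro ⟨hc, hu⟩
    have hsum : (Pi.single j 1 : ZMod m → ZMod 2) =
        labelCode c ⟨c j - 1, by omega⟩ -
          ∑ k ∈ Finset.univ.filter (fun k => c k = c j ∧ k ≠ j), Pi.single k 1 := by
      funext x
      have hcj : c j - 1 + 1 = c j := by omega
      simp only [Pi.sub_apply, Finset.sum_apply, labelCode, hcj, Pi.single_apply,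
        Finset.sum_ite_eq, Finset.mem_filter, Finset.mem_univ, true_and]
      by_cases hx : x = j
      · simp [hx]
      · simp [hx]
    rw [hsum]
    refine Submodule.sub_mem _ (Submodule.subset_span (.inl ⟨_, rfl⟩))
      (Submodule.sum_mem _ fun k hk => Submodule.subset_span (.inr ⟨k, ?_, rfl⟩))
    simp only [Finset.mem_filter, Finset.mem_univ, true_and] at hk
    by_contra hks
    exact hk.2 (hu k hks hk.1)

/-- The complement of a side information set is a window of `m - s` consecutive indices. -/
lemma notMem_sideInfo_iff {m s : ℕ} [NeZero m] (hsm : s ≤ m) (i j : ZMod m) :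
    j ∉ sideInfo m s i ↔
      ∃ x : ℕ, ((i + 1).val ≤ x ∧ x < (i + 1).val + (m - s)) ∧ (x : ZMod m) = j := by
  have hlt := ZMod.val_lt (j - (i + 1))
  have hval : ((j - (i + 1)).val : ZMod m) = j - (i + 1) := ZMod.natCast_zmod_val _
  have hval' : ((i + 1).val : ZMod m) = i + 1 := ZMod.natCast_zmod_val _
  constructor
  · intro hj
    refine ⟨(i + 1).val + (j - (i + 1)).val, ⟨by omega, ?_⟩, ?_⟩
    · by_contra hge
      refine hj ⟨m - 1 - (j - (i + 1)).val, Finset.mem_range.2 (by omega), ?_⟩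
      rw [Nat.sub_sub, Nat.cast_sub (by omega)]
      push_cast
      rw [hval, CharP.cast_eq_zero]
      ring
    · push_cast
      rw [hval, hval']
      ring
  · rintro ⟨x, ⟨hx1, hx2⟩, rfl⟩ ⟨k, hk, hxk⟩
    rw [Finset.mem_range] at hk
    obtain ⟨y, rfl⟩ := Nat.exists_eq_add_of_le hx1
    have h0 : ((y + k + 1 : ℕ) : ZMod m) = 0 := by
      push_cast at hxk ⊢
      rw [hval'] at hxk
      linear_combination hxk
    rw [ZMod.natCast_eq_zero_iff] at h0
    have := Nat.le_of_dvd (by omega) h0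
    omega

end SDPicod

open SDPicod

theorem feasible_m_le_three_s_div_two (m s : ℕ) (hs : 5 ≤ s)
    (hm1 : s + 4 ≤ m) (hm2 : 2 * m ≤ 3 * s) (hndvd : ¬ (m - s) ∣ m) :
    ∃ ℓ ≤ 4, ∃ G : Fin ℓ → ZMod m → ZMod 2,
      IsDecentralizedCode m s G ∧ Correct m s G ∧ Secure m s G := by
  have : NeZero m := ⟨by omega⟩
  obtain ⟨F, hF⟩ := exists_goodWord (m := m) (d := m - s) (by omega) (by omega) hndvd
  have hsm : s ≤ m := by omega
  have cast_inj : ∀ a x y : ℕ, a ≤ x → x < a + (m - s) → a ≤ y → y < a + (m - s) →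
      (x : ZMod m) = y → x = y := by
    intro a x y hx1 hx2 hy1 hy2 h
    rw [ZMod.natCast_eq_natCast_iff] at h
    exact h.eq_of_abs_lt (by rw [abs_lt]; omega)
  have label : ∀ a < m, ∀ x, a ≤ x → x < a + (m - s) → F (x : ZMod m).val = F x := by
    intro a ha x hx1 hx2
    rw [ZMod.val_natCast]
    rcases lt_or_ge x m with h | h
    · rw [Nat.mod_eq_of_lt h]
    · obtain ⟨y, rfl⟩ := Nat.exists_eq_add_of_le' h
      rw [Nat.add_mod_right, Nat.mod_eq_of_lt (by omega), hF.wrap y (by omega)]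
  have dec : ∀ i, ∃! j, j ∈ decSet m s (labelCode fun x : ZMod m => F x.val) i := by
    intro i
    have ha := ZMod.val_lt (i + 1)
    obtain ⟨l, ⟨hl, x, ⟨⟨hx1, hx2⟩, hx⟩, hxu⟩, hlu⟩ := hF.once _ ha
    refine ⟨x, ?_, ?_⟩
    · show (x : ZMod m) ∈ decSet m s _ i
      rw [mem_decSet_labelCode_iff, label _ ha x hx1 hx2]
      refine ⟨(notMem_sideInfo_iff hsm _ _).2 ⟨x, ⟨hx1, hx2⟩, rfl⟩, hx ▸ hl, ?_⟩
      intro k hk hkl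
      obtain ⟨y, ⟨hy1, hy2⟩, rfl⟩ := (notMem_sideInfo_iff hsm _ _).1 hk
      rw [label _ ha y hy1 hy2] at hkl
      rw [hxu y ⟨⟨hy1, hy2⟩, hkl.trans hx⟩]
    · intro j hj
      rw [mem_decSet_labelCode_iff] at hj
      obtain ⟨hjs, hjl, hju⟩ := hj
      obtain ⟨y, ⟨hy1, hy2⟩, rfl⟩ := (notMem_sideInfo_iff hsm _ _).1 hjs
      rw [label _ ha y hy1 hy2] at hjl hju
      have hy : F y = l := by
        refine hlu _ ⟨hjl, y, ⟨⟨hy1, hy2⟩, rfl⟩, ?_⟩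
        rintro z ⟨⟨hz1, hz2⟩, hz⟩
        refine cast_inj _ z y hz1 hz2 hy1 hy2 (hju z ?_ ?_)
        · exact (notMem_sideInfo_iff hsm _ _).2 ⟨z, ⟨hz1, hz2⟩, rfl⟩
        · rw [label _ ha z hz1 hz2, hz]
      rw [hxu y ⟨⟨hy1, hy2⟩, hy⟩]
  refine ⟨3, by norm_num, labelCode fun x : ZMod m => F x.val, ?_, ?_, ?_⟩
  · intro t
    obtain ⟨a, ha, hav⟩ := hF.avoid (t + 1) (by omega) (by omega)
    refine ⟨a - 1, fun j hj => ?_⟩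
    by_contra hjs
    obtain ⟨x, ⟨hx1, hx2⟩, rfl⟩ := (notMem_sideInfo_iff hsm _ _).1 hjs
    rw [sub_add_cancel, ZMod.val_natCast, Nat.mod_eq_of_lt ha] at hx1 hx2
    apply hj
    refine if_neg ?_
    exact (label a ha x hx1 hx2).trans_ne (hav x hx1 hx2)
  · exact fun i => (dec i).exists
  · exact fun i j hj k hk => (dec i).unique hj hk
end
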